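/- arXiv:2212.00547 — 2 statements merged into one kernel-verified Lean document; each statement's English description precedes it below -/
import Mathlib

section
/- Let (X,d,μ) be a metric measure space satisfying the doubling condition with constants C₀, D > 0, in which every ball has finite positive measure. Let T be a heat-kernel family on (X,μ) and let h : X → (0,∞) be measurable and T-harmonic, and suppose the matched two-sided Gaussian estimate (ULG_h) holds. Then there exist C, δ, c₃ > 0 such that for all t > 0 and all x, y, y₀ ∈ X (outside a μ-null set) with d(y,y₀) ≤ √t, one has |T_t(x,y)/(h(x)h(y)) − T_t(x,y₀)/(h(x)h(y₀))| ≤ C (d(y,y₀)/√t)^δ μ_{h²}(B(x,√t))⁻¹ exp(−d(x,y)²/(c₃ t)). -/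
open MeasureTheory Metric Filter Set
open scoped ENNReal NNReal

noncomputable section

variable {X : Type*} [MetricSpace X] [MeasurableSpace X] [BorelSpace X]

/-- The doubling condition with constants `C₀, D`. -/
def Doubling (μ : Measure X) (C₀ D : ℝ) : Prop :=
  0 < C₀ ∧ 0 < D ∧ ∀ (x : X) (r R : ℝ), 0 < r → r ≤ R →
    μ (ball x R) ≤ ENNReal.ofReal (C₀ * (R / r) ^ D) * μ (ball x r)

/-- Every ball has finite positive measure. -/
def BallsFinitePos (μ : Measure X) : Prop :=
  ∀ (x : X) (r : ℝ), 0 < r → 0 < μ (ball x r) ∧ μ (ball x r) < ⊤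

/-- A heat-kernel family: measurable, nonnegative, symmetric, and satisfying the
semigroup property almost everywhere. -/
structure IsHeatKernel (μ : Measure X) (T : ℝ → X → X → ℝ) : Prop where
  meas : Measurable fun p : ℝ × X × X => T p.1 p.2.1 p.2.2
  nonneg : ∀ t x y, 0 ≤ T t x y
  symm : ∀ t x y, T t x y = T t y x
  semigroup : ∀ s t : ℝ, 0 < s → 0 < t → ∀ᵐ p ∂(μ.prod μ),
    T (s + t) p.1 p.2 = ∫ z, T s p.1 z * T t z p.2 ∂μ

/-- The measure with density `w` with respect to `μ`. -/
def densMeasure (μ : Measure X) (w : X → ℝ) : Measure X :=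
  μ.withDensity fun x => ENNReal.ofReal (w x)

/-- The upper Gaussian estimate (UG) with constants `C, c`. -/
def UG (μ : Measure X) (T : ℝ → X → X → ℝ) (C c : ℝ) : Prop :=
  0 < C ∧ 0 < c ∧ ∀ t : ℝ, 0 < t → ∀ᵐ p ∂(μ.prod μ),
    ENNReal.ofReal (T t p.1 p.2) * μ (ball p.1 (Real.sqrt t))
      ≤ ENNReal.ofReal (C * Real.exp (-(dist p.1 p.2) ^ 2 / (c * t)))

/-- `h` is `T`-harmonic. -/
def THarmonic (μ : Measure X) (T : ℝ → X → X → ℝ) (h : X → ℝ) : Prop :=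
  ∀ t : ℝ, 0 < t → ∀ᵐ x ∂μ, ∫ y, T t x y * h y ∂μ = h x

/-- The matched two-sided Gaussian estimate (ULG_h) with constants `C, c₁, c₂`. -/
def ULG (μ : Measure X) (T : ℝ → X → X → ℝ) (h : X → ℝ) (C c₁ c₂ : ℝ) : Prop :=
  0 < C ∧ 0 < c₁ ∧ 0 < c₂ ∧ ∀ t : ℝ, 0 < t → ∀ᵐ p ∂(μ.prod μ),
    ENNReal.ofReal (C⁻¹ * (h p.1 * h p.2) * Real.exp (-(dist p.1 p.2) ^ 2 / (c₁ * t)))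
        ≤ ENNReal.ofReal (T t p.1 p.2)
            * densMeasure μ (fun z => h z ^ 2) (ball p.1 (Real.sqrt t))
    ∧ ENNReal.ofReal (T t p.1 p.2)
            * densMeasure μ (fun z => h z ^ 2) (ball p.1 (Real.sqrt t))
        ≤ ENNReal.ofReal (C * (h p.1 * h p.2) * Real.exp (-(dist p.1 p.2) ^ 2 / (c₂ * t)))

/-- The reverse Hölder class `RH_∞(μ)` with constant `C`. -/
def RHInf (μ : Measure X) (w : X → ℝ) (C : ℝ) : Prop :=
  ∀ (x₀ : X) (R : ℝ), 0 < R → ∀ᵐ x ∂μ, x ∈ ball x₀ R →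
    w x ≤ C * ((μ (ball x₀ R)).toReal)⁻¹ * ∫ y in ball x₀ R, w y ∂μ

/-- The reverse Hölder class `RH_q(μ)` with constant `C`. -/
def RHq (μ : Measure X) (w : X → ℝ) (q C : ℝ) : Prop :=
  ∀ (x₀ : X) (R : ℝ), 0 < R →
    (((μ (ball x₀ R)).toReal)⁻¹ * ∫ y in ball x₀ R, w y ^ q ∂μ) ^ (1 / q)
      ≤ C * ((μ (ball x₀ R)).toReal)⁻¹ * ∫ y in ball x₀ R, w y ∂μ

/-- A `(μ; h₁,…,h_m; r)`-atom. -/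
def IsHAtom (μ : Measure X) {m : ℕ} (hs : Fin m → X → ℝ) (r : ℝ) (a : X → ℝ) : Prop :=
  AEStronglyMeasurable a μ ∧
  ∃ (x₀ : X) (R : ℝ), 0 < R ∧
    (∀ x, x ∉ ball x₀ R → a x = 0) ∧
    eLpNorm a (ENNReal.ofReal r) μ ≤ (μ (ball x₀ R)) ^ (1 / r - 1 : ℝ) ∧
    ∀ j, Integrable (fun x => a x * hs j x) μ ∧ ∫ x, a x * hs j x ∂μ = 0

/-- An atomic decomposition of `f`, converging in `L¹(μ)`. -/
def AtomicRep (μ : Measure X) {m : ℕ} (hs : Fin m → X → ℝ) (r : ℝ) (f : X → ℝ)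
    (lam : ℕ → ℝ) (a : ℕ → X → ℝ) : Prop :=
  (∀ k, IsHAtom μ hs r (a k)) ∧ Summable (fun k => |lam k|) ∧
  Tendsto (fun n => eLpNorm (fun x => f x - ∑ k ∈ Finset.range n, lam k * a k x) 1 μ)
    atTop (nhds 0)

/-- The atomic Hardy space norm: the infimum of `∑ |λ_k|` over atomic decompositions. -/
def atomicNorm (μ : Measure X) {m : ℕ} (hs : Fin m → X → ℝ) (r : ℝ) (f : X → ℝ) : ℝ :=
  sInf {s : ℝ | ∃ (lam : ℕ → ℝ) (a : ℕ → X → ℝ), AtomicRep μ hs r f lam a ∧ (∑' k, |lam k|) = s}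

/-- The heat maximal function `M_T f (x) = sup_{t>0} |∫ T_t(x,y) f(y) dμ(y)|`. -/
def maxFun (μ : Measure X) (T : ℝ → X → X → ℝ) (f : X → ℝ) (x : X) : ℝ≥0∞ :=
  ⨆ (t : ℝ) (_ : 0 < t), ENNReal.ofReal |∫ y, T t x y * f y ∂μ|

/-- `inf_{u ∈ span(h₁,…,h_m)} (μ(B)⁻¹ ∫_B |g-u|^{r'} dμ)^{1/r'}` for the ball `B(x₀,R)`. -/
def bmoBall (μ : Measure X) {m : ℕ} (hs : Fin m → X → ℝ) (r' : ℝ) (g : X → ℝ)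
    (x₀ : X) (R : ℝ) : ℝ≥0∞ :=
  ⨅ c : Fin m → ℝ,
    ((μ (ball x₀ R))⁻¹ *
      ∫⁻ x in ball x₀ R, ENNReal.ofReal (|g x - ∑ j, c j * hs j x| ^ r') ∂μ) ^ (1 / r')

/-- `‖g‖_{BMO(μ;h₁,…,h_m;r')} ≤ N`. -/
def BMOLe (μ : Measure X) {m : ℕ} (hs : Fin m → X → ℝ) (r' : ℝ) (g : X → ℝ) (N : ℝ) : Prop :=
  ∀ (x₀ : X) (R : ℝ), 0 < R → bmoBall μ hs r' g x₀ R ≤ ENNReal.ofReal N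

/-- `g ∈ L^{r'}_loc(μ)`. -/
def LocLr (μ : Measure X) (r' : ℝ) (g : X → ℝ) : Prop :=
  ∀ (x₀ : X) (R : ℝ), 0 < R → IntegrableOn (fun x => |g x| ^ r') (ball x₀ R) μ

/-- Two nonnegative weights of equal mass `M` are compared through their product coupling. -/
lemma integral_mul_sub_integral_mul_le {α : Type*} [MeasurableSpace α] {ν : Measure α}
    {q q' g φ φ' : α → ℝ} {M A : ℝ}
    (hq0 : ∀ z, 0 ≤ q z) (hq0' : ∀ z, 0 ≤ q' z)
    (hq : Integrable q ν) (hq' : Integrable q' ν)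
    (hqM : ∫ z, q z ∂ν = M) (hqM' : ∫ z, q' z ∂ν = M)
    (hgq : Integrable (fun z => g z * q z) ν) (hgq' : Integrable (fun z => g z * q' z) ν)
    (hφ : Integrable (fun z => φ z * q z) ν) (hφ' : Integrable (fun z => φ' z * q' z) ν)
    (h : ∀ᵐ z ∂ν, ∀ᵐ z' ∂ν, g z - g z' ≤ A + φ z + φ' z') :
    ∫ z, g z * q z ∂ν - ∫ z, g z * q' z ∂ν
      ≤ A * M + ∫ z, φ z * q z ∂ν + ∫ z, φ' z * q' z ∂ν := by
  have hM0 : 0 ≤ M := hqM ▸ integral_nonneg hq0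
  rcases hM0.eq_or_lt with hM | hM
  · have e : q =ᵐ[ν] 0 :=
      (integral_eq_zero_iff_of_nonneg hq0 hq).1 (hqM.trans hM.symm)
    have e' : q' =ᵐ[ν] 0 :=
      (integral_eq_zero_iff_of_nonneg hq0' hq').1 (hqM'.trans hM.symm)
    have key : ∀ (f p : α → ℝ), p =ᵐ[ν] 0 → ∫ z, f z * p z ∂ν = 0 := by
      intro f p hp
      refine integral_eq_zero_of_ae ?_
      filter_upwards [hp] with z hz
      simp [hz]
    rw [key g q e, key g q' e', key φ q e, key φ' q' e', ← hM]
    simp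
  · have inner : ∀ᵐ z ∂ν, g z * M - ∫ z', g z' * q' z' ∂ν
        ≤ (A + φ z) * M + ∫ z', φ' z' * q' z' ∂ν := by
      filter_upwards [h] with z hz
      have h1 : ∫ z', (g z * q' z' - g z' * q' z') ∂ν
          ≤ ∫ z', ((A + φ z) * q' z' + φ' z' * q' z') ∂ν := by
        refine integral_mono_ae ((hq'.const_mul _).sub hgq') ((hq'.const_mul _).add hφ') ?_
        filter_upwards [hz] with z' hz'
        have := mul_le_mul_of_nonneg_right hz' (hq0' z')
        linarith
      rw [integral_sub (hq'.const_mul _) hgq', integral_add (hq'.const_mul _) hφ',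
        integral_const_mul, integral_const_mul, hqM'] at h1
      exact h1
    set G' := ∫ z', g z' * q' z' ∂ν
    set P' := ∫ z', φ' z' * q' z' ∂ν
    have h2 : ∫ z, (M * (g z * q z) - G' * q z) ∂ν
        ≤ ∫ z, ((A * M + P') * q z + M * (φ z * q z)) ∂ν := by
      refine integral_mono_ae ((hgq.const_mul _).sub (hq.const_mul _))
        ((hq.const_mul _).add (hφ.const_mul _)) ?_
      filter_upwards [inner] with z hz
      have := mul_le_mul_of_nonneg_right hz (hq0 z)
      linarith
    rw [integral_sub (hgq.const_mul _) (hq.const_mul _),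
      integral_add (hq.const_mul _) (hφ.const_mul _),
      integral_const_mul, integral_const_mul, integral_const_mul, integral_const_mul, hqM] at h2
    refine le_of_mul_le_mul_left ?_ hM
    linarith

/-- Two probability densities with overlap at least `ε` contract the oscillation of `g`. -/
lemma integral_mul_sub_le_of_overlap {ν : Measure X} {p p' g : X → ℝ} {y y' : X}
    {K a ρ ε B : ℝ} (hK : 0 ≤ K) (ha : 0 ≤ a) (hρ : 0 < ρ)
    (hp0 : ∀ z, 0 ≤ p z) (hp0' : ∀ z, 0 ≤ p' z)
    (hp : Integrable p ν) (hp' : Integrable p' ν)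
    (hp1 : ∫ z, p z ∂ν = 1) (hp1' : ∫ z, p' z ∂ν = 1)
    (hgm : AEStronglyMeasurable g ν)
    (hgp : Integrable (fun z => g z * p z) ν) (hgp' : Integrable (fun z => g z * p' z) ν)
    (hd : Integrable (fun z => dist y z / ρ * p z) ν)
    (hd' : Integrable (fun z => dist y' z / ρ * p' z) ν)
    (hB : ∫ z, dist y z / ρ * p z ∂ν ≤ B) (hB' : ∫ z, dist y' z / ρ * p' z ∂ν ≤ B)
    (hε : ε ≤ ∫ z, min (p z) (p' z) ∂ν)
    (h : ∀ᵐ z ∂ν, ∀ᵐ z' ∂ν, |g z - g z'| ≤ K * (1 + a * (dist z z' / (2 * ρ)))) :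
    ∫ z, g z * p z ∂ν - ∫ z, g z * p' z ∂ν
      ≤ K * ((1 - ε) * (1 + a / 2 * (dist y y' / ρ)) + a * B) := by
  have hmin0 : ∀ z, 0 ≤ min (p z) (p' z) := fun z => le_min (hp0 z) (hp0' z)
  have hmin : Integrable (fun z => min (p z) (p' z)) ν := hp.inf hp'
  have hbd : ∀ {f r : X → ℝ}, AEStronglyMeasurable f ν → Integrable r ν → (∀ z, 0 ≤ r z) →
      Integrable (fun z => f z * r z) ν →
      (∀ z, min (p z) (p' z) ≤ r z) → Integrable (fun z => f z * min (p z) (p' z)) ν := by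
    intro f r hf hr hr0 hfr hle
    refine hfr.mono (hf.mul hmin.aestronglyMeasurable) (Eventually.of_forall fun z => ?_)
    rw [norm_mul, norm_mul]
    refine mul_le_mul_of_nonneg_left ?_ (norm_nonneg _)
    rw [Real.norm_of_nonneg (hmin0 z), Real.norm_of_nonneg (hr0 z)]
    exact hle z
  set q : X → ℝ := fun z => p z - min (p z) (p' z) with hq
  set q' : X → ℝ := fun z => p' z - min (p z) (p' z) with hq'
  have hgmin := hbd hgm hp hp0 hgp fun z => min_le_left _ _
  have hgq : Integrable (fun z => g z * q z) ν :=
    (hgp.sub hgmin).congr (Eventually.of_forall fun _ => (mul_sub _ _ _).symm)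
  have hgq' : Integrable (fun z => g z * q' z) ν :=
    (hgp'.sub hgmin).congr (Eventually.of_forall fun _ => (mul_sub _ _ _).symm)
  have hmd : ∀ w : X, AEStronglyMeasurable (fun z => dist w z / ρ) ν := fun w =>
    (Measurable.aestronglyMeasurable (by
      have : Continuous fun z => dist w z / ρ := by fun_prop
      exact this.measurable))
  have hdmin := hbd (hmd y) hp hp0 hd fun z => min_le_left _ _
  have hdmin' := hbd (hmd y') hp' hp0' hd' fun z => min_le_right _ _
  set m := ∫ z, min (p z) (p' z) ∂ν with hm
  have e1 : ∫ z, q z ∂ν = 1 - m := by rw [hq, integral_sub hp hmin, hp1]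
  have e2 : ∫ z, q' z ∂ν = 1 - m := by rw [hq', integral_sub hp' hmin, hp1']
  have hK' : 0 ≤ K * a / 2 := by positivity
  have hφ : ∀ {w : X} {r : X → ℝ}, Integrable (fun z => dist w z / ρ * r z) ν →
      Integrable (fun z => dist w z / ρ * min (p z) (p' z)) ν →
      Integrable (fun z => K * a / 2 * (dist w z / ρ) * (r z - min (p z) (p' z))) ν := by
    intro w r h1 h2
    refine ((h1.sub h2).const_mul (K * a / 2)).congr (Eventually.of_forall fun z => ?_)
    simp only [Pi.sub_apply]
    ring
  have hφle : ∀ {w : X} {r : X → ℝ}, Integrable (fun z => dist w z / ρ * r z) ν →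
      Integrable (fun z => dist w z / ρ * min (p z) (p' z)) ν →
      ∫ z, dist w z / ρ * r z ∂ν ≤ B →
      ∫ z, K * a / 2 * (dist w z / ρ) * (r z - min (p z) (p' z)) ∂ν ≤ K * a / 2 * B := by
    intro w r h1 h2 h3
    refine le_trans ?_ (mul_le_mul_of_nonneg_left h3 hK')
    rw [← integral_const_mul]
    refine integral_mono (hφ h1 h2) (h1.const_mul _) fun z => ?_
    have : 0 ≤ K * a / 2 * (dist w z / ρ) * min (p z) (p' z) :=
      mul_nonneg (mul_nonneg hK' (by positivity)) (hmin0 z)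
    simp only
    linarith
  have main := integral_mul_sub_integral_mul_le (ν := ν) (q := q) (q' := q') (g := g)
    (φ := fun z => K * a / 2 * (dist y z / ρ)) (φ' := fun z => K * a / 2 * (dist y' z / ρ))
    (M := 1 - m) (A := K * (1 + a / 2 * (dist y y' / ρ)))
    (fun z => sub_nonneg.2 (min_le_left _ _)) (fun z => sub_nonneg.2 (min_le_right _ _))
    (hp.sub hmin) (hp'.sub hmin) e1 e2 hgq hgq' (hφ hd hdmin) (hφ hd' hdmin') (by
      filter_upwards [h] with z hz
      filter_upwards [hz] with z' hz'
      refine (le_abs_self _).trans (hz'.trans ?_)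
      have tri : dist z z' ≤ dist y y' + dist y z + dist y' z' := by
        have t1 := dist_triangle z y z'
        have t2 := dist_triangle y y' z'
        rw [dist_comm z y] at t1
        linarith
      have : K * a / 2 * (dist z z' / ρ)
          ≤ K * a / 2 * ((dist y y' + dist y z + dist y' z') / ρ) := by gcongr
      have e : K * (1 + a * (dist z z' / (2 * ρ))) = K + K * a / 2 * (dist z z' / ρ) := by
        field_simp
      rw [e]
      refine (add_le_add_right this K).trans (le_of_eq ?_)
      ring)
  have e3 : ∫ z, g z * q z ∂ν - ∫ z, g z * q' z ∂ν
      = ∫ z, g z * p z ∂ν - ∫ z, g z * p' z ∂ν := by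
    simp only [hq, hq', mul_sub]
    rw [integral_sub hgp hgmin, integral_sub hgp' hgmin]
    ring
  rw [e3] at main
  have l1 := hφle hd hdmin hB
  have l2 := hφle hd' hdmin' hB'
  have l3 : K * (1 + a / 2 * (dist y y' / ρ)) * (1 - m)
      ≤ K * (1 + a / 2 * (dist y y' / ρ)) * (1 - ε) := by
    refine mul_le_mul_of_nonneg_left (by linarith) (by positivity)
  refine main.trans ((add_le_add (add_le_add l3 l1) l2).trans (le_of_eq ?_))
  ring

/-- A symmetric Markov semigroup kernel on `(X, ν)` with two-sided Gaussian bounds; the bounds are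
parametrized by the spatial scale `ρ`, which corresponds to the time `ρ ^ 2`. -/
structure IsGaussianMarkovKernel (ν : Measure X) (k : ℝ → X → X → ℝ) (C c₁ c₂ : ℝ) : Prop where
  C_pos : 0 < C
  c₁_pos : 0 < c₁
  c₂_pos : 0 < c₂
  meas : ∀ t x, Measurable (k t x)
  nonneg : ∀ t x y, 0 ≤ k t x y
  symm : ∀ t x y, k t x y = k t y x
  ball_pos : ∀ x r, 0 < r → 0 < ν.real (ball x r)
  mass : ∀ t, 0 < t → ∀ᵐ y ∂ν, Integrable (k t y) ν ∧ ∫ z, k t y z ∂ν = 1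
  semigroup : ∀ s t, 0 < s → 0 < t → ∀ᵐ x ∂ν, ∀ᵐ y ∂ν,
    k (s + t) x y = ∫ w, k s x w * k t w y ∂ν
  lower : ∀ ρ, 0 < ρ → ∀ᵐ y ∂ν, ∀ᵐ z ∂ν,
    C⁻¹ * Real.exp (-((dist y z / ρ) ^ 2 / c₁)) ≤ k (ρ ^ 2) y z * ν.real (ball y ρ)
  upper : ∀ ρ, 0 < ρ → ∀ᵐ y ∂ν, ∀ᵐ z ∂ν,
    k (ρ ^ 2) y z * ν.real (ball y ρ) ≤ C * Real.exp (-((dist y z / ρ) ^ 2 / c₂))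

/-- The point `y` is not exceptional for any of the almost everywhere properties at scale `ρ`. -/
structure IsGoodAt (ν : Measure X) (k : ℝ → X → X → ℝ) (C c₁ c₂ ρ : ℝ) (y : X) : Prop where
  integrable : Integrable (k (ρ ^ 2) y) ν
  integral_eq_one : ∫ z, k (ρ ^ 2) y z ∂ν = 1
  lower : ∀ᵐ z ∂ν,
    C⁻¹ * Real.exp (-((dist y z / ρ) ^ 2 / c₁)) ≤ k (ρ ^ 2) y z * ν.real (ball y ρ)
  upper : ∀ᵐ z ∂ν,
    k (ρ ^ 2) y z * ν.real (ball y ρ) ≤ C * Real.exp (-((dist y z / ρ) ^ 2 / c₂))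

/-- The constant in the first moment bound for a Gaussian Markov kernel. -/
def momentConst (C c₁ c₂ : ℝ) : ℝ := C ^ 3 * (1 + 2 * c₂) * Real.exp (2 * c₂ / c₁ / c₁)

/-- The lower bound for the overlap of two kernels based at points at most `N` scales apart. -/
def overlapConst (C c₁ N : ℝ) : ℝ :=
  C⁻¹ * Real.exp (-((N + 1) ^ 2 / c₁)) / (C * Real.exp ((N + 1) ^ 2 / c₁))

/-- The slope of the modulus `1 + slopeConst * r` contracted by a Gaussian Markov kernel. -/
def slopeConst (C c₁ c₂ : ℝ) : ℝ :=
  min (1 / 4) (overlapConst C c₁ (4 * (1 + momentConst C c₁ c₂)) / (1 + momentConst C c₁ c₂))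

lemma mul_measureReal_ball_le_integral {ν : Measure X} {f : X → ℝ} {y : X} {r c : ℝ}
    (hf : Integrable f ν) (hf0 : ∀ z, 0 ≤ f z) (hfin : ν (ball y r) ≠ ⊤)
    (h : ∀ᵐ z ∂ν, z ∈ ball y r → c ≤ f z) : c * ν.real (ball y r) ≤ ∫ z, f z ∂ν := by
  have h1 : ∫ _ in ball y r, c ∂ν ≤ ∫ z in ball y r, f z ∂ν :=
    setIntegral_mono_on_ae (integrableOn_const hfin) hf.integrableOn measurableSet_ball h
  rw [setIntegral_const, smul_eq_mul, mul_comm] at h1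
  exact h1.trans (setIntegral_le_integral hf (Eventually.of_forall hf0))

lemma mul_exp_neg_sq_le {c : ℝ} (hc : 0 < c) (x : ℝ) :
    x * Real.exp (-(x ^ 2 / c)) ≤ (1 + 2 * c) * Real.exp (-(x ^ 2 / (2 * c))) := by
  have e : Real.exp (-(x ^ 2 / c))
      = Real.exp (-(x ^ 2 / (2 * c))) * Real.exp (-(x ^ 2 / (2 * c))) := by
    rw [← Real.exp_add]; congr 1; field_simp; ring
  have h1 : x ≤ (1 + 2 * c) * Real.exp (x ^ 2 / (2 * c)) := by
    have h2 := Real.add_one_le_exp (x ^ 2 / (2 * c))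
    have h3 : (1 + 2 * c) * (x ^ 2 / (2 * c) + 1) = x ^ 2 / (2 * c) + 1 + x ^ 2 + 2 * c := by
      field_simp; ring
    have h4 : 0 ≤ x ^ 2 / (2 * c) := by positivity
    have h5 := mul_le_mul_of_nonneg_left h2 (by positivity : 0 ≤ 1 + 2 * c)
    nlinarith [sq_nonneg (x - 1)]
  have h6 : x * Real.exp (-(x ^ 2 / (2 * c))) ≤ 1 + 2 * c := by
    rw [Real.exp_neg]
    exact mul_inv_le_of_le_mul₀ (Real.exp_pos _).le (by positivity) h1
  rw [e, ← mul_assoc]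
  exact mul_le_mul_of_nonneg_right h6 (Real.exp_pos _).le

lemma abs_sub_mul_le_of_mul_le {p p' V E : ℝ} (hp : 0 ≤ p) (hp' : 0 ≤ p') (hV : 0 ≤ V)
    (h : p * V ≤ E) (h' : p' * V ≤ E) : |p - p'| * V ≤ E := by
  have h1 := mul_nonneg hp hV
  have h2 := mul_nonneg hp' hV
  rcases abs_cases (p - p') with ⟨e, -⟩ | ⟨e, -⟩ <;> rw [e] <;> linarith

namespace IsGaussianMarkovKernel

variable {ν : Measure X} {k : ℝ → X → X → ℝ} {C c₁ c₂ : ℝ}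

lemma ball_ne_top (hk : IsGaussianMarkovKernel ν k C c₁ c₂) (x : X) {r : ℝ} (hr : 0 < r) :
    ν (ball x r) ≠ ⊤ := fun h => by
  simpa [measureReal_def, h] using hk.ball_pos x r hr

lemma ae_isGoodAt (hk : IsGaussianMarkovKernel ν k C c₁ c₂) {ρ : ℝ} (hρ : 0 < ρ) :
    ∀ᵐ y ∂ν, IsGoodAt ν k C c₁ c₂ ρ y := by
  filter_upwards [hk.mass (ρ ^ 2) (by positivity), hk.lower ρ hρ, hk.upper ρ hρ] with y h1 h2 h3
  exact ⟨h1.1, h1.2, h2, h3⟩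

lemma ball_mul_le (hk : IsGaussianMarkovKernel ν k C c₁ c₂) {ρ A : ℝ} {y : X} (hρ : 0 < ρ)
    (hA : 0 < A) (hy : IsGoodAt ν k C c₁ c₂ ρ y) :
    ν.real (ball y (A * ρ)) ≤ C * Real.exp (A ^ 2 / c₁) * ν.real (ball y ρ) := by
  have hC := hk.C_pos
  have hc := hk.c₁_pos
  have hV := hk.ball_pos y ρ hρ
  have h1 := mul_measureReal_ball_le_integral (c := C⁻¹ * Real.exp (-(A ^ 2 / c₁)) /
    ν.real (ball y ρ)) hy.integrable (hk.nonneg _ _) (hk.ball_ne_top y (by positivity : 0 < A * ρ))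
    (by
      filter_upwards [hy.lower] with z hz hzb
      rw [div_le_iff₀ hV]
      refine le_trans ?_ hz
      have : dist y z / ρ ≤ A := by
        rw [div_le_iff₀ hρ, dist_comm]; exact (mem_ball.1 hzb).le
      gcongr)
  rw [hy.integral_eq_one, Real.exp_neg, div_mul_eq_mul_div, div_le_one hV, ← mul_inv,
    inv_mul_le_iff₀ (by positivity)] at h1
  exact h1

lemma momentConst_pos (hk : IsGaussianMarkovKernel ν k C c₁ c₂) : 0 < momentConst C c₁ c₂ := by
  have := hk.C_pos
  have := hk.c₂_pos
  unfold momentConst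
  positivity

lemma overlapConst_pos (hk : IsGaussianMarkovKernel ν k C c₁ c₂) (N : ℝ) :
    0 < overlapConst C c₁ N := by
  have := hk.C_pos
  unfold overlapConst
  positivity

lemma slopeConst_pos (hk : IsGaussianMarkovKernel ν k C c₁ c₂) : 0 < slopeConst C c₁ c₂ := by
  have := hk.momentConst_pos
  have := hk.overlapConst_pos (4 * (1 + momentConst C c₁ c₂))
  exact lt_min (by norm_num) (by positivity)

lemma first_moment (hk : IsGaussianMarkovKernel ν k C c₁ c₂) {ρ : ℝ} {y : X} (hρ : 0 < ρ)
    (hy : IsGoodAt ν k C c₁ c₂ ρ y) (hy' : IsGoodAt ν k C c₁ c₂ (√(2 * c₂ / c₁) * ρ) y) :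
    Integrable (fun z => dist y z / ρ * k (ρ ^ 2) y z) ν ∧
      ∫ z, dist y z / ρ * k (ρ ^ 2) y z ∂ν ≤ momentConst C c₁ c₂ := by
  have hC := hk.C_pos
  have hc₁ := hk.c₁_pos
  have hc₂ := hk.c₂_pos
  set l := √(2 * c₂ / c₁) with hl
  have hl0 : 0 < l := Real.sqrt_pos.2 (by positivity)
  have hl2 : l ^ 2 = 2 * c₂ / c₁ := Real.sq_sqrt (by positivity)
  have hV := hk.ball_pos y ρ hρ
  have hdom : ∀ᵐ z ∂ν, dist y z / ρ * k (ρ ^ 2) y z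
      ≤ momentConst C c₁ c₂ * k ((l * ρ) ^ 2) y z := by
    filter_upwards [hy.upper, hy'.lower] with z hu hlow
    have hx : 0 ≤ dist y z / ρ := by positivity
    set x := dist y z / ρ with hxdef
    have e : (dist y z / (l * ρ)) ^ 2 / c₁ = x ^ 2 / (2 * c₂) := by
      have : dist y z / (l * ρ) = x / l := by rw [hxdef]; field_simp
      rw [this, div_pow, hl2]; field_simp
    rw [e] at hlow
    have hk0 := hk.nonneg ((l * ρ) ^ 2) y z
    have hVl := hk.ball_mul_le hρ hl0 hy
    rw [hl2] at hVl
    refine le_of_mul_le_mul_right ?_ hV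
    calc x * k (ρ ^ 2) y z * ν.real (ball y ρ)
        = x * (k (ρ ^ 2) y z * ν.real (ball y ρ)) := by ring
      _ ≤ x * (C * Real.exp (-(x ^ 2 / c₂))) := by gcongr
      _ = C * (x * Real.exp (-(x ^ 2 / c₂))) := by ring
      _ ≤ C * ((1 + 2 * c₂) * Real.exp (-(x ^ 2 / (2 * c₂)))) := by
          gcongr C * ?_
          exact mul_exp_neg_sq_le hc₂ x
      _ = C ^ 2 * (1 + 2 * c₂) * (C⁻¹ * Real.exp (-(x ^ 2 / (2 * c₂)))) := by
          field_simp
      _ ≤ C ^ 2 * (1 + 2 * c₂) * (k ((l * ρ) ^ 2) y z * ν.real (ball y (l * ρ))) := by gcongr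
      _ ≤ C ^ 2 * (1 + 2 * c₂) * (k ((l * ρ) ^ 2) y z *
            (C * Real.exp (2 * c₂ / c₁ / c₁) * ν.real (ball y ρ))) := by gcongr
      _ = momentConst C c₁ c₂ * k ((l * ρ) ^ 2) y z * ν.real (ball y ρ) := by
          unfold momentConst; ring
  have hdm : Measurable fun z => dist y z / ρ := by
    have : Continuous fun z => dist y z / ρ := by fun_prop
    exact this.measurable
  have hint : Integrable (fun z => dist y z / ρ * k (ρ ^ 2) y z) ν := by
    refine (hy'.integrable.const_mul (momentConst C c₁ c₂)).mono'
      (hdm.mul (hk.meas _ _)).aestronglyMeasurable ?_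
    filter_upwards [hdom] with z hz
    rwa [Real.norm_of_nonneg (mul_nonneg (by positivity) (hk.nonneg _ _ _))]
  refine ⟨hint, ?_⟩
  have := integral_mono_ae hint (hy'.integrable.const_mul _) hdom
  rwa [integral_const_mul, hy'.integral_eq_one, mul_one] at this

lemma overlapConst_le_integral_min (hk : IsGaussianMarkovKernel ν k C c₁ c₂) {ρ N : ℝ} {y y' : X}
    (hρ : 0 < ρ) (hN : 0 ≤ N) (hy : IsGoodAt ν k C c₁ c₂ ρ y) (hy' : IsGoodAt ν k C c₁ c₂ ρ y')
    (hd : dist y y' ≤ N * ρ) :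
    overlapConst C c₁ N ≤ ∫ z, min (k (ρ ^ 2) y z) (k (ρ ^ 2) y' z) ∂ν := by
  have hC := hk.C_pos
  have hc := hk.c₁_pos
  have hV := hk.ball_pos y ρ hρ
  have hV' := hk.ball_pos y' ρ hρ
  set E := C * Real.exp ((N + 1) ^ 2 / c₁) with hE
  have hE0 : 0 < E := by positivity
  have hbig := hk.ball_mul_le hρ (by linarith : 0 < N + 1) hy
  have hfin := hk.ball_ne_top y (by positivity : 0 < (N + 1) * ρ)
  have hVy : ν.real (ball y ρ) ≤ E * ν.real (ball y ρ) :=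
    (measureReal_mono (ball_subset_ball (by nlinarith)) hfin).trans hbig
  have hVy' : ν.real (ball y' ρ) ≤ E * ν.real (ball y ρ) := by
    refine (measureReal_mono (ball_subset_ball' ?_) hfin).trans hbig
    rw [dist_comm]; linarith
  have hlow : ∀ w, (∀ᵐ z ∂ν, C⁻¹ * Real.exp (-((dist w z / ρ) ^ 2 / c₁))
      ≤ k (ρ ^ 2) w z * ν.real (ball w ρ)) → ν.real (ball w ρ) ≤ E * ν.real (ball y ρ) →
      dist y w ≤ N * ρ → ∀ᵐ z ∂ν, z ∈ ball y ρ →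
        overlapConst C c₁ N / ν.real (ball y ρ) ≤ k (ρ ^ 2) w z := by
    intro w hw hVw hdw
    filter_upwards [hw] with z hz hzb
    have hdist : dist w z / ρ ≤ N + 1 := by
      rw [div_le_iff₀ hρ]
      have t := dist_triangle w y z
      have t' := mem_ball.1 hzb
      rw [dist_comm w y, dist_comm y z] at t
      linarith
    have h1 : C⁻¹ * Real.exp (-((N + 1) ^ 2 / c₁)) ≤ k (ρ ^ 2) w z * (E * ν.real (ball y ρ)) := by
      calc C⁻¹ * Real.exp (-((N + 1) ^ 2 / c₁))
          ≤ C⁻¹ * Real.exp (-((dist w z / ρ) ^ 2 / c₁)) := by gcongr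
        _ ≤ k (ρ ^ 2) w z * ν.real (ball w ρ) := hz
        _ ≤ _ := mul_le_mul_of_nonneg_left hVw (hk.nonneg _ _ _)
    rw [overlapConst, ← hE, div_div]
    rwa [div_le_iff₀ (by positivity)]
  have := mul_measureReal_ball_le_integral (hy.integrable.inf hy'.integrable)
    (fun z => le_min (hk.nonneg _ _ _) (hk.nonneg _ _ _)) (hk.ball_ne_top y hρ)
    (c := overlapConst C c₁ N / ν.real (ball y ρ)) (by
      filter_upwards [hlow y hy.lower hVy (by simpa using by positivity),
        hlow y' hy'.lower hVy' hd] with z h1 h2 hzb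
      exact le_min (h1 hzb) (h2 hzb))
  rwa [div_mul_cancel₀ _ hV.ne'] at this

/-- One application of the kernel at scale `ρ` contracts a modulus of continuity by the factor
`1 - slopeConst` while halving its scale. -/
lemma abs_integral_sub_le (hk : IsGaussianMarkovKernel ν k C c₁ c₂) {ρ K : ℝ} {y y' : X}
    {g : X → ℝ} (hρ : 0 < ρ) (hK : 0 ≤ K)
    (hy : IsGoodAt ν k C c₁ c₂ ρ y) (hy₂ : IsGoodAt ν k C c₁ c₂ (√(2 * c₂ / c₁) * ρ) y)
    (hy' : IsGoodAt ν k C c₁ c₂ ρ y') (hy₂' : IsGoodAt ν k C c₁ c₂ (√(2 * c₂ / c₁) * ρ) y')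
    (hgm : AEStronglyMeasurable g ν)
    (hgy : Integrable (fun z => g z * k (ρ ^ 2) y z) ν)
    (hgy' : Integrable (fun z => g z * k (ρ ^ 2) y' z) ν)
    (h : ∀ᵐ z ∂ν, ∀ᵐ z' ∂ν,
      |g z - g z'| ≤ K * (1 + slopeConst C c₁ c₂ * (dist z z' / (2 * ρ)))) :
    |∫ z, g z * k (ρ ^ 2) y z ∂ν - ∫ z, g z * k (ρ ^ 2) y' z ∂ν|
      ≤ K * (1 - slopeConst C c₁ c₂) * (1 + slopeConst C c₁ c₂ * (dist y y' / ρ)) := by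
  have ha := hk.slopeConst_pos
  have hB := hk.momentConst_pos
  have hε := hk.overlapConst_pos (4 * (1 + momentConst C c₁ c₂))
  set B := momentConst C c₁ c₂ with hBdef
  set a := slopeConst C c₁ c₂ with hadef
  have ha4 : a ≤ 1 / 4 := min_le_left _ _
  have haε : a * (1 + B) ≤ overlapConst C c₁ (4 * (1 + B)) := by
    rw [← le_div_iff₀ (by positivity)]
    exact min_le_right _ _
  have hx : 0 ≤ dist y y' / ρ := by positivity
  have key : ∃ ε, ε ≤ ∫ z, min (k (ρ ^ 2) y z) (k (ρ ^ 2) y' z) ∂ν ∧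
      (1 - ε) * (1 + a / 2 * (dist y y' / ρ)) + a * B ≤ (1 - a) * (1 + a * (dist y y' / ρ)) := by
    rcases le_total (dist y y' / ρ) (4 * (1 + B)) with hN | hN
    · refine ⟨_, hk.overlapConst_le_integral_min hρ (N := 4 * (1 + B)) (by positivity) hy hy'
        ((div_le_iff₀ hρ).1 hN), ?_⟩
      generalize dist y y' / ρ = x at *
      generalize overlapConst C c₁ (4 * (1 + B)) = ε at *
      have h0 : 0 ≤ a * x := by positivity
      have h1 : 0 ≤ ε * (a * x) := by positivity
      have h2 : a * (a * x) ≤ 1 / 4 * (a * x) := by gcongr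
      linarith
    · refine ⟨0, integral_nonneg fun z => le_min (hk.nonneg _ _ _) (hk.nonneg _ _ _), ?_⟩
      generalize dist y y' / ρ = x at *
      have h0 : a * (4 * (1 + B)) ≤ a * x := by gcongr
      have h2 : a * (a * x) ≤ 1 / 4 * (a * x) := by gcongr
      linarith
  obtain ⟨ε, hε1, hε2⟩ := key
  obtain ⟨m1, m2⟩ := hk.first_moment hρ hy hy₂
  obtain ⟨m1', m2'⟩ := hk.first_moment hρ hy' hy₂'
  have fin : K * ((1 - ε) * (1 + a / 2 * (dist y y' / ρ)) + a * B)
      ≤ K * (1 - a) * (1 + a * (dist y y' / ρ)) := by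
    rw [mul_assoc]
    exact mul_le_mul_of_nonneg_left hε2 hK
  rw [abs_le']
  constructor
  · exact (integral_mul_sub_le_of_overlap hK ha.le hρ (hk.nonneg _ _) (hk.nonneg _ _)
      hy.integrable hy'.integrable hy.integral_eq_one hy'.integral_eq_one hgm hgy hgy' m1 m1' m2 m2'
      hε1 h).trans fin
  · rw [neg_sub]
    have hε1' : ε ≤ ∫ z, min (k (ρ ^ 2) y' z) (k (ρ ^ 2) y z) ∂ν := by
      simpa only [min_comm] using hε1
    have := integral_mul_sub_le_of_overlap hK ha.le hρ (hk.nonneg _ _) (hk.nonneg _ _)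
      hy'.integrable hy.integrable hy'.integral_eq_one hy.integral_eq_one hgm hgy' hgy m1' m1 m2' m2
      hε1' h
    rw [dist_comm y' y] at this
    exact this.trans fin

lemma ae_upper_bound (hk : IsGaussianMarkovKernel ν k C c₁ c₂) {s : ℝ} (hs : 0 < s) :
    ∀ᵐ x ∂ν, ∀ᵐ y ∂ν, k s x y ≤ C / ν.real (ball x √s) := by
  have hρ := Real.sqrt_pos.2 hs
  have hC := hk.C_pos
  have hc := hk.c₂_pos
  filter_upwards [hk.upper _ hρ] with x hx
  filter_upwards [hx] with y hy
  rw [Real.sq_sqrt hs.le] at hy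
  rw [le_div_iff₀ (hk.ball_pos x _ hρ)]
  refine hy.trans (mul_le_of_le_one_right hC.le ?_)
  rw [Real.exp_le_one_iff, neg_nonpos]
  positivity

/-- Closeness of `k s x ·` to a constant at scale `R / 2 ^ n`, for times `s` close to `R ^ 2`. -/
lemma ae_abs_sub_mul_le (hk : IsGaussianMarkovKernel ν k C c₁ c₂) {R : ℝ} (hR : 0 < R) (n : ℕ) :
    ∀ s, R ^ 2 * (1 - (1 / 4) ^ n / 2) ≤ s → s ≤ R ^ 2 → ∀ᵐ x ∂ν, ∀ᵐ y ∂ν, ∀ᵐ y' ∂ν,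
      |k s x y - k s x y'| * ν.real (ball x R) ≤ C ^ 2 * Real.exp (2 / c₁) *
        (1 - slopeConst C c₁ c₂) ^ n * (1 + slopeConst C c₁ c₂ * (dist y y' / (R / 2 ^ n))) := by
  have hC := hk.C_pos
  have hc₁ := hk.c₁_pos
  have ha := hk.slopeConst_pos
  have ha4 : slopeConst C c₁ c₂ ≤ 1 / 4 := min_le_left _ _
  have hR2 : 0 < R ^ 2 := by positivity
  induction n with
  | zero =>
    intro s hs1 hs2
    have hs : 0 < s := by norm_num at hs1; linarith
    have hρ := Real.sqrt_pos.2 hs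
    filter_upwards [hk.ae_isGoodAt hρ, hk.ae_upper_bound hs] with x hx hxu
    have hVρ := hk.ball_pos x _ hρ
    have hV := hk.ball_pos x _ hR
    have hball : ν.real (ball x R) ≤ C * Real.exp (2 / c₁) * ν.real (ball x √s) := by
      have := hk.ball_mul_le hρ (by positivity : 0 < R / √s) hx
      rw [div_mul_cancel₀ _ hρ.ne', div_pow, Real.sq_sqrt hs.le] at this
      refine this.trans ?_
      have : R ^ 2 / s ≤ 2 := by
        rw [div_le_iff₀ hs]; norm_num at hs1; linarith
      gcongr
    have hbd : ∀ y, k s x y ≤ C / ν.real (ball x √s) →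
        k s x y * ν.real (ball x R) ≤ C ^ 2 * Real.exp (2 / c₁) := by
      intro y hy
      calc k s x y * ν.real (ball x R)
          ≤ C / ν.real (ball x √s) * (C * Real.exp (2 / c₁) * ν.real (ball x √s)) := by gcongr
        _ = _ := by field_simp
    filter_upwards [hxu] with y hy
    filter_upwards [hxu] with y' hy'
    have h1 := hbd y hy
    have h2 := hbd y' hy'
    refine (abs_sub_mul_le_of_mul_le (hk.nonneg s x y) (hk.nonneg s x y') hV.le h1 h2).trans ?_
    rw [pow_zero, mul_one]
    refine le_mul_of_one_le_right (by positivity) ?_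
    have : 0 ≤ slopeConst C c₁ c₂ * (dist y y' / (R / 2 ^ 0)) := by positivity
    linarith
  | succ n ih =>
    intro s hs1 hs2
    set ρ := R / 2 ^ (n + 1) with hρdef
    have hρ : 0 < ρ := by positivity
    have hρ2 : ρ ^ 2 = R ^ 2 * ((1 / 4) ^ n / 4) := by
      have : ((2 : ℝ) ^ (n + 1)) ^ 2 = 4 * 4 ^ n := by
        rw [← pow_mul, mul_comm (n + 1), pow_mul, pow_succ]
        norm_num
        ring
      rw [hρdef, div_pow, this, one_div, inv_pow]
      field_simp
    have h2ρ : 2 * ρ = R / 2 ^ n := by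
      rw [hρdef, pow_succ]; field_simp
    have hpow : (0 : ℝ) < (1 / 4) ^ n := by positivity
    have hpow1 : (1 / 4 : ℝ) ^ n ≤ 1 := pow_le_one₀ (by norm_num) (by norm_num)
    have hRp : 0 < R ^ 2 * (1 / 4) ^ n := by positivity
    have hRp1 : R ^ 2 * (1 / 4) ^ n ≤ R ^ 2 := mul_le_of_le_one_right hR2.le hpow1
    rw [pow_succ (1 / 4 : ℝ)] at hs1
    generalize (1 / 4 : ℝ) ^ n = P at hρ2 hpow hpow1 hRp hRp1 hs1 ih
    have hs' : 0 < s - ρ ^ 2 := by rw [hρ2]; linarith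
    have hl : 0 < √(2 * c₂ / c₁) * ρ := by
      have := hk.c₂_pos
      positivity
    have hgood := (hk.ae_isGoodAt hρ).and (hk.ae_isGoodAt hl)
    filter_upwards [ih (s - ρ ^ 2) (by rw [hρ2]; linarith) (by linarith [sq_nonneg ρ]),
      hk.semigroup _ _ hs' (by positivity : 0 < ρ ^ 2), hk.ae_upper_bound hs'] with x hx hsg hxu
    have hV := hk.ball_pos x _ hR
    have hint : ∀ y, IsGoodAt ν k C c₁ c₂ ρ y →
        Integrable (fun z => k (s - ρ ^ 2) x z * k (ρ ^ 2) y z) ν := by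
      intro y hy
      refine hy.integrable.bdd_mul (c := C / ν.real (ball x √(s - ρ ^ 2)))
        (hk.meas _ _).aestronglyMeasurable ?_
      filter_upwards [hxu] with z hz
      rwa [Real.norm_of_nonneg (hk.nonneg _ _ _)]
    have hrepr : ∀ᵐ y ∂ν, k s x y = ∫ w, k (s - ρ ^ 2) x w * k (ρ ^ 2) y w ∂ν := by
      filter_upwards [hsg] with y hy
      rw [sub_add_cancel] at hy
      rw [hy]
      exact integral_congr_ae (Eventually.of_forall fun w => by
        simp only [hk.symm _ w y])
    filter_upwards [hrepr, hgood] with y hy hyg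
    filter_upwards [hrepr, hgood] with y' hy' hyg'
    rw [hy, hy', ← le_div_iff₀ hV]
    refine (hk.abs_integral_sub_le (K := C ^ 2 * Real.exp (2 / c₁) *
      (1 - slopeConst C c₁ c₂) ^ n / ν.real (ball x R)) hρ
      (div_nonneg (mul_nonneg (by positivity) (pow_nonneg (by linarith) _)) hV.le)
      hyg.1 hyg.2 hyg'.1 hyg'.2 (hk.meas _ _).aestronglyMeasurable (hint y hyg.1) (hint y' hyg'.1)
      ?_).trans (le_of_eq ?_)
    · filter_upwards [hx] with z hz
      filter_upwards [hz] with z' hz'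
      rw [h2ρ, div_mul_eq_mul_div, le_div_iff₀ hV]
      exact hz'
    · rw [pow_succ]
      ring

lemma ae_abs_sub_mul_le_exp (hk : IsGaussianMarkovKernel ν k C c₁ c₂) {R : ℝ} (hR : 0 < R) :
    ∀ᵐ x ∂ν, ∀ᵐ y ∂ν, ∀ᵐ y' ∂ν, dist y y' ≤ R →
      |k (R ^ 2) x y - k (R ^ 2) x y'| * ν.real (ball x R)
        ≤ C * Real.exp (1 / c₂) * Real.exp (-((dist x y / R) ^ 2 / (2 * c₂))) := by
  have hC := hk.C_pos
  have hc := hk.c₂_pos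
  filter_upwards [hk.upper R hR] with x hx
  filter_upwards [hx] with y hy
  filter_upwards [hx] with y' hy' hd
  have hV := hk.ball_pos x _ hR
  set u := dist x y / R
  set u' := dist x y' / R
  have hu' : 0 ≤ u' := by positivity
  have hu0 : 0 ≤ u := by positivity
  have huu : u ≤ u' + 1 := by
    have := dist_triangle x y' y
    rw [dist_comm y' y] at this
    have h : u ≤ (dist x y' + R) / R := div_le_div_of_nonneg_right (by linarith) hR.le
    rwa [add_div, div_self hR.ne'] at h
  have hsq : u ^ 2 ≤ 2 * u' ^ 2 + 2 := by nlinarith [sq_nonneg (u' - 1)]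
  have hE : ∀ v : ℝ, u ^ 2 ≤ 2 * v ^ 2 + 2 → C * Real.exp (-(v ^ 2 / c₂)) ≤
      C * Real.exp (1 / c₂) * Real.exp (-(u ^ 2 / (2 * c₂))) := by
    intro v hv
    rw [mul_assoc, ← Real.exp_add]
    gcongr
    rw [← sub_nonneg]
    have : 1 / c₂ + -(u ^ 2 / (2 * c₂)) - -(v ^ 2 / c₂) = (2 * v ^ 2 + 2 - u ^ 2) / (2 * c₂) := by
      field_simp
      ring
    rw [this]
    exact div_nonneg (by linarith) (by positivity)
  have h1 := hy.trans (hE u (by nlinarith [sq_nonneg u]))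
  have h2 := hy'.trans (hE u' hsq)
  exact abs_sub_mul_le_of_mul_le (hk.nonneg _ _ _) (hk.nonneg _ _ _) hV.le h1 h2

/-- Hölder continuity without the Gaussian factor. -/
lemma exists_ae_abs_sub_mul_le_rpow (hk : IsGaussianMarkovKernel ν k C c₁ c₂) :
    ∃ C' δ : ℝ, 0 < C' ∧ 0 < δ ∧ ∀ R, 0 < R → ∀ᵐ x ∂ν, ∀ᵐ y ∂ν, ∀ᵐ y' ∂ν, dist y y' ≤ R →
      |k (R ^ 2) x y - k (R ^ 2) x y'| * ν.real (ball x R) ≤ C' * (dist y y' / R) ^ δ := by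
  have hC := hk.C_pos
  have ha := hk.slopeConst_pos
  have ha4 : slopeConst C c₁ c₂ ≤ 1 / 4 := min_le_left _ _
  set a := slopeConst C c₁ c₂
  set δ := Real.logb (1 / 2) (1 - a) with hδ
  have hδ0 : 0 < δ :=
    Real.logb_pos_of_base_lt_one (by norm_num) (by norm_num) (by linarith) (by linarith)
  have hθ : (1 / 2 : ℝ) ^ δ = 1 - a := Real.rpow_logb (by norm_num) (by norm_num) (by linarith)
  set K := C ^ 2 * Real.exp (2 / c₁)
  have hK : 0 < K := by positivity
  refine ⟨2 * K * 2 ^ δ, δ, by positivity, hδ0, fun R hR => ?_⟩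
  have hall : ∀ᵐ x ∂ν, ∀ n : ℕ, ∀ᵐ y ∂ν, ∀ᵐ y' ∂ν,
      |k (R ^ 2) x y - k (R ^ 2) x y'| * ν.real (ball x R)
        ≤ K * (1 - a) ^ n * (1 + a * (dist y y' / (R / 2 ^ n))) :=
    ae_all_iff.2 fun n => hk.ae_abs_sub_mul_le hR n (R ^ 2)
      (mul_le_of_le_one_right (by positivity) (by
        have : (0 : ℝ) < (1 / 4) ^ n := by positivity
        linarith)) le_rfl
  filter_upwards [hall] with x hx
  filter_upwards [ae_all_iff.2 hx] with y hy
  filter_upwards [ae_all_iff.2 hy] with y' hy' hd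
  rcases eq_or_ne y y' with rfl | hne
  · simp [Real.zero_rpow hδ0.ne']
  have hr0 : 0 < dist y y' / R := div_pos (dist_pos.2 hne) hR
  have hr1 : dist y y' / R ≤ 1 := (div_le_one hR).2 hd
  obtain ⟨n, hn1, hn2⟩ := exists_nat_pow_near_of_lt_one hr0 hr1
    (by norm_num : (0 : ℝ) < 1 / 2) (by norm_num)
  refine (hy' n).trans ?_
  have e : dist y y' / (R / 2 ^ n) = dist y y' / R * 2 ^ n := by field_simp
  rw [e]
  set r := dist y y' / R
  have h1 : r * 2 ^ n ≤ 1 := by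
    have := mul_le_mul_of_nonneg_right hn2 (by positivity : (0 : ℝ) ≤ 2 ^ n)
    rwa [← mul_pow, one_div, inv_mul_cancel₀ two_ne_zero, one_pow] at this
  have h2 : 1 + a * (r * 2 ^ n) ≤ 2 := by nlinarith
  have h3 : (1 - a) ^ n ≤ 2 ^ δ * r ^ δ := by
    rw [← Real.mul_rpow (by norm_num) hr0.le, ← hθ, ← Real.rpow_natCast, ← Real.rpow_mul (by norm_num),
      mul_comm δ, Real.rpow_mul (by norm_num), Real.rpow_natCast]
    refine Real.rpow_le_rpow (by positivity) ?_ hδ0.le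
    rw [pow_succ] at hn1
    linarith
  calc K * (1 - a) ^ n * (1 + a * (r * 2 ^ n)) ≤ K * (2 ^ δ * r ^ δ) * 2 := by gcongr
    _ = _ := by ring

theorem exists_holder (hk : IsGaussianMarkovKernel ν k C c₁ c₂) :
    ∃ C' δ : ℝ, 0 < C' ∧ 0 < δ ∧ ∀ R, 0 < R → ∀ᵐ x ∂ν, ∀ᵐ y ∂ν, ∀ᵐ y' ∂ν, dist y y' ≤ R →
      |k (R ^ 2) x y - k (R ^ 2) x y'| * ν.real (ball x R)
        ≤ C' * (dist y y' / R) ^ δ * Real.exp (-((dist x y / R) ^ 2 / (4 * c₂))) := by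
  obtain ⟨C₁, δ, hC₁, hδ, H⟩ := hk.exists_ae_abs_sub_mul_le_rpow
  have hC := hk.C_pos
  have hc := hk.c₂_pos
  set K := max C₁ (C * Real.exp (1 / c₂))
  have hK : 0 < K := lt_max_of_lt_left hC₁
  refine ⟨K, δ / 2, hK, by positivity, fun R hR => ?_⟩
  filter_upwards [H R hR, hk.ae_abs_sub_mul_le_exp hR] with x h1 h2
  filter_upwards [h1, h2] with y h1 h2
  filter_upwards [h1, h2] with y' h1 h2 hd
  specialize h1 hd
  specialize h2 hd
  have hr : 0 ≤ dist y y' / R := by positivity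
  have h1' : _ ≤ K * (dist y y' / R) ^ δ :=
    h1.trans (mul_le_mul_of_nonneg_right (le_max_left _ _) (by positivity))
  have h2' : _ ≤ K * Real.exp (-((dist x y / R) ^ 2 / (2 * c₂))) :=
    h2.trans (mul_le_mul_of_nonneg_right (le_max_right _ _) (by positivity))
  refine abs_le_of_sq_le_sq' ?_ (by positivity) |>.2
  have e1 : ((dist y y' / R) ^ (δ / 2)) ^ 2 = (dist y y' / R) ^ δ := by
    rw [← Real.rpow_natCast, ← Real.rpow_mul hr]
    norm_num
  have e2 : Real.exp (-((dist x y / R) ^ 2 / (4 * c₂))) ^ 2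
      = Real.exp (-((dist x y / R) ^ 2 / (2 * c₂))) := by
    rw [← Real.exp_nat_mul]
    congr 1
    push_cast
    field_simp
    ring
  rw [mul_pow (K * _), mul_pow K, e1, e2, sq]
  refine (mul_le_mul h1' h2' (by positivity) (by positivity)).trans (le_of_eq ?_)
  ring

end IsGaussianMarkovKernel

lemma BallsFinitePos.sigmaFinite {μ : Measure X} (hμ : BallsFinitePos μ) : SigmaFinite μ := by
  rcases isEmpty_or_nonempty X with hX | ⟨⟨x⟩⟩
  · rw [Measure.eq_zero_of_isEmpty μ]
    infer_instance
  · refine ⟨⟨⟨fun n => ball x n, fun _ => mem_univ _, fun n => ?_, iUnion_ball_nat x⟩⟩⟩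
    rcases n.eq_zero_or_pos with rfl | hn
    · simp
    · exact (hμ x n (by exact_mod_cast hn)).2

lemma BallsFinitePos.secondCountableTopology {μ : Measure X} (hμ : BallsFinitePos μ) :
    SecondCountableTopology X := by
  have := hμ.sigmaFinite
  refine Metric.secondCountable_of_almost_dense_set fun ε hε => ?_
  obtain ⟨u, -, hdisj, hcov⟩ :=
    Vitali.exists_disjoint_subfamily_covering_enlargement_closedBall (univ : Set X) id
      (fun _ => ε / 4) (ε / 4) (fun _ _ => le_rfl) 4 (by norm_num)
  refine ⟨u, ?_, fun x => ?_⟩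
  · have := Measure.countable_meas_pos_of_disjoint_iUnion (μ := μ)
      (As := fun i : u => closedBall (i : X) (ε / 4)) (fun _ => measurableSet_closedBall)
      (hdisj.subtype _ _)
    rw [← countable_coe_iff, ← countable_univ_iff]
    refine this.mono fun i _ => ?_
    exact (hμ i (ε / 4) (by positivity)).1.trans_le (measure_mono ball_subset_closedBall)
  · obtain ⟨y, hy, hxy⟩ := hcov x (mem_univ x)
    refine ⟨y, hy, ?_⟩
    have := hxy (mem_closedBall_self (by positivity))
    rw [mem_closedBall] at this
    simpa using this.trans (by linarith)

section Doob

variable {μ : Measure X} {h : X → ℝ}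

lemma ae_densMeasure_sq (hm : Measurable h) (hpos : ∀ x, 0 < h x) :
    ae (densMeasure μ fun z => h z ^ 2) = ae μ := by
  refine le_antisymm (withDensity_absolutelyContinuous _ _).ae_le
    (withDensity_absolutelyContinuous' (by fun_prop) (Eventually.of_forall fun x => ?_)).ae_le
  simpa using (hpos x).ne'

lemma integral_densMeasure_sq (hm : Measurable h) (f : X → ℝ) :
    ∫ z, f z ∂(densMeasure μ fun z => h z ^ 2) = ∫ z, f z * h z ^ 2 ∂μ := by
  rw [densMeasure, integral_withDensity_eq_integral_toReal_smul (by fun_prop)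
    (Eventually.of_forall fun _ => ENNReal.ofReal_lt_top)]
  refine integral_congr_ae (Eventually.of_forall fun z => ?_)
  simp only [smul_eq_mul]
  rw [ENNReal.toReal_ofReal (sq_nonneg _), mul_comm]

lemma integrable_densMeasure_sq_iff (hm : Measurable h) {f : X → ℝ} :
    Integrable f (densMeasure μ fun z => h z ^ 2) ↔ Integrable (fun z => f z * h z ^ 2) μ := by
  rw [densMeasure, integrable_withDensity_iff (by fun_prop)
    (Eventually.of_forall fun _ => ENNReal.ofReal_lt_top)]
  simp only [ENNReal.toReal_ofReal (sq_nonneg _)]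

lemma densMeasure_sq_ball_pos (hμ : BallsFinitePos μ) (hm : Measurable h) (hpos : ∀ x, 0 < h x)
    (x : X) {r : ℝ} (hr : 0 < r) : 0 < densMeasure μ (fun z => h z ^ 2) (ball x r) := by
  rw [pos_iff_ne_zero, Ne, ← frequently_ae_mem_iff.not_left, ae_densMeasure_sq hm hpos,
    frequently_ae_mem_iff.not_left]
  exact (hμ x r hr).1.ne'

lemma ULG.densMeasure_ball_lt_top [SFinite μ] {T : ℝ → X → X → ℝ} {C c₁ c₂ : ℝ}
    (hULG : ULG μ T h C c₁ c₂) (hμ : BallsFinitePos μ) (hpos : ∀ x, 0 < h x) (x : X) {r : ℝ}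
    (hr : 0 < r) : densMeasure μ (fun z => h z ^ 2) (ball x r) < ⊤ := by
  obtain ⟨hC, -, -, H⟩ := hULG
  have hball : ∃ᵐ z ∂μ, z ∈ ball x r := frequently_ae_mem_iff.2 (hμ x r hr).1.ne'
  obtain ⟨y, hy, hyb⟩ := ((Measure.ae_ae_of_ae_prod
    (H ((2 * r) ^ 2) (by positivity))).and_frequently hball).exists
  obtain ⟨z, ⟨hz1, hz2⟩, -⟩ := (hy.and_frequently hball).exists
  rw [Real.sqrt_sq (by positivity)] at hz1 hz2
  have hsub : ball x r ⊆ ball y (2 * r) := ball_subset_ball' (by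
    have := mem_ball'.1 hyb
    linarith)
  refine (measure_mono hsub).trans_lt (lt_top_iff_ne_top.2 fun htop => ?_)
  rw [htop] at hz1 hz2
  have hT : ENNReal.ofReal (T ((2 * r) ^ 2) y z) = 0 := by
    by_contra hne
    rw [ENNReal.mul_top hne, top_le_iff] at hz2
    exact ENNReal.ofReal_ne_top hz2
  rw [hT, zero_mul, nonpos_iff_eq_zero, ENNReal.ofReal_eq_zero] at hz1
  have h1 := hpos y
  have h2 := hpos z
  exact absurd hz1 (not_le.2 (by positivity))

/-- The Doob transform of a heat kernel by a harmonic function is a Gaussian Markov kernel. -/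
lemma isGaussianMarkovKernel_doob [SFinite μ] {T : ℝ → X → X → ℝ} {C c₁ c₂ : ℝ}
    (hμ : BallsFinitePos μ) (hT : IsHeatKernel μ T) (hm : Measurable h) (hpos : ∀ x, 0 < h x)
    (hharm : THarmonic μ T h) (hULG : ULG μ T h C c₁ c₂) :
    IsGaussianMarkovKernel (densMeasure μ fun z => h z ^ 2)
      (fun t x y => T t x y / (h x * h y)) C c₁ c₂ := by
  have hfin := fun x (r : ℝ) (hr : 0 < r) => hULG.densMeasure_ball_lt_top hμ hpos x hr
  obtain ⟨hC, hc₁, hc₂, H⟩ := hULG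
  have hTm : ∀ t x, Measurable (T t x) := fun t x =>
    hT.meas.comp (measurable_const.prodMk (measurable_const.prodMk measurable_id))
  have hbounds : ∀ ρ : ℝ, 0 < ρ → ∀ᵐ y ∂μ, ∀ᵐ z ∂μ,
      C⁻¹ * Real.exp (-((dist y z / ρ) ^ 2 / c₁)) ≤ T (ρ ^ 2) y z / (h y * h z) *
        (densMeasure μ fun z => h z ^ 2).real (ball y ρ) ∧
      T (ρ ^ 2) y z / (h y * h z) * (densMeasure μ fun z => h z ^ 2).real (ball y ρ)
        ≤ C * Real.exp (-((dist y z / ρ) ^ 2 / c₂)) := by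
    intro ρ hρ
    filter_upwards [Measure.ae_ae_of_ae_prod (H (ρ ^ 2) (by positivity))] with y hy
    filter_upwards [hy] with z hz
    rw [Real.sqrt_sq hρ.le] at hz
    set V := (densMeasure μ fun z => h z ^ 2) (ball y ρ) with hV
    have hVtop : V ≠ ⊤ := (hfin y ρ hρ).ne
    have hh : 0 < h y * h z := mul_pos (hpos y) (hpos z)
    have e : ∀ c : ℝ, -dist y z ^ 2 / (c * ρ ^ 2) = -((dist y z / ρ) ^ 2 / c) := by
      intro c
      rw [div_pow, div_div, neg_div, mul_comm]
    rw [← ENNReal.ofReal_toReal hVtop, ← ENNReal.ofReal_mul (hT.nonneg _ _ _),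
      ENNReal.ofReal_le_ofReal_iff (mul_nonneg (hT.nonneg _ _ _) ENNReal.toReal_nonneg),
      ENNReal.ofReal_le_ofReal_iff (by positivity)] at hz
    simp only [e] at hz
    rw [measureReal_def, ← hV, div_mul_eq_mul_div, le_div_iff₀ hh, div_le_iff₀ hh]
    exact ⟨by linarith [hz.1], by linarith [hz.2]⟩
  have hne : ∀ x, h x ≠ 0 := fun x => (hpos x).ne'
  refine ⟨hC, hc₁, hc₂, fun t x => (hTm t x).div (measurable_const.mul hm),
    fun t x y => div_nonneg (hT.nonneg _ _ _) (mul_pos (hpos x) (hpos y)).le,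
    fun t x y => by rw [hT.symm, mul_comm], fun x r hr => ?_, fun t ht => ?_,
    fun s t hs ht => ?_, fun ρ hρ => ?_, fun ρ hρ => ?_⟩
  · exact ENNReal.toReal_pos (densMeasure_sq_ball_pos hμ hm hpos x hr).ne' (hfin x r hr).ne
  · rw [ae_densMeasure_sq hm hpos]
    filter_upwards [hharm t ht] with y hy
    have e : (fun z => T t y z / (h y * h z) * h z ^ 2) = fun z => T t y z * h z / h y := by
      funext z
      have := hne y
      have := hne z
      field_simp
    rw [integrable_densMeasure_sq_iff hm, integral_densMeasure_sq hm, e, integral_div, hy,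
      div_self (hne y)]
    exact ⟨(not_imp_comm.1 integral_undef (hy ▸ hne y)).div_const _, rfl⟩
  · rw [ae_densMeasure_sq hm hpos]
    filter_upwards [Measure.ae_ae_of_ae_prod (hT.semigroup s t hs ht)] with x hx
    filter_upwards [hx] with y hy
    rw [hy, integral_densMeasure_sq hm, ← integral_div]
    refine integral_congr_ae (Eventually.of_forall fun w => ?_)
    have := hne x
    have := hne y
    have := hne w
    simp only
    field_simp
  · rw [ae_densMeasure_sq hm hpos]
    filter_upwards [hbounds ρ hρ] with y hy
    exact hy.mono fun z hz => hz.1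
  · rw [ae_densMeasure_sq hm hpos]
    filter_upwards [hbounds ρ hρ] with y hy
    exact hy.mono fun z hz => hz.2

end Doob

/-- Hölder continuity of the Doob-transformed kernel, as a consequence of
the doubling condition and the matched two-sided Gaussian estimate (ULG_h). -/
theorem stmt_5
    (μ : Measure X) (C₀ D : ℝ) (hdoub : Doubling μ C₀ D) (hballs : BallsFinitePos μ)
    (T : ℝ → X → X → ℝ) (hT : IsHeatKernel μ T)
    (h : X → ℝ) (hhmeas : Measurable h) (hhpos : ∀ x, 0 < h x)
    (hharm : THarmonic μ T h)
    (CU c₁ c₂ : ℝ) (hULG : ULG μ T h CU c₁ c₂) :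
    ∃ C δ c₃ : ℝ, 0 < C ∧ 0 < δ ∧ 0 < c₃ ∧ ∀ t : ℝ, 0 < t →
      ∀ᵐ p ∂(μ.prod (μ.prod μ)), dist p.2.1 p.2.2 ≤ Real.sqrt t →
        ENNReal.ofReal
            |T t p.1 p.2.1 / (h p.1 * h p.2.1) - T t p.1 p.2.2 / (h p.1 * h p.2.2)|
            * densMeasure μ (fun z => h z ^ 2) (ball p.1 (Real.sqrt t))
          ≤ ENNReal.ofReal (C * (dist p.2.1 p.2.2 / Real.sqrt t) ^ δ *
              Real.exp (-(dist p.1 p.2.1) ^ 2 / (c₃ * t))) := by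
  have := hballs.sigmaFinite
  have := hballs.secondCountableTopology
  have hk := isGaussianMarkovKernel_doob hballs hT hhmeas hhpos hharm hULG
  obtain ⟨C, δ, hC, hδ, H⟩ := hk.exists_holder
  have hc₂ := hk.c₂_pos
  refine ⟨C, δ, 4 * c₂, hC, hδ, by positivity, fun t ht => ?_⟩
  have hR : 0 < √t := Real.sqrt_pos.2 ht
  have hTm : Measurable fun p : X × X => T t p.1 p.2 := hT.meas.comp measurable_prodMk_left
  have hν : SFinite (densMeasure μ fun z => h z ^ 2) := by
    unfold densMeasure
    infer_instance
  have hVm : Measurable fun x => densMeasure μ (fun z => h z ^ 2) (ball x √t) := by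
    have hs : MeasurableSet {p : X × X | dist p.2 p.1 < √t} :=
      measurableSet_lt (by fun_prop) measurable_const
    exact measurable_measure_prodMk_left hs
  have hS : MeasurableSet {p : X × X × X | dist p.2.1 p.2.2 ≤ √t →
      ENNReal.ofReal
          |T t p.1 p.2.1 / (h p.1 * h p.2.1) - T t p.1 p.2.2 / (h p.1 * h p.2.2)|
          * densMeasure μ (fun z => h z ^ 2) (ball p.1 √t)
        ≤ ENNReal.ofReal (C * (dist p.2.1 p.2.2 / √t) ^ δ *
            Real.exp (-(dist p.1 p.2.1) ^ 2 / (4 * c₂ * t)))} := by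
    have h1 : Measurable fun p : X × X × X => T t p.1 p.2.1 :=
      hTm.comp (measurable_fst.prodMk (measurable_fst.comp measurable_snd))
    have h2 : Measurable fun p : X × X × X => T t p.1 p.2.2 :=
      hTm.comp (measurable_fst.prodMk (measurable_snd.comp measurable_snd))
    have h3 : Measurable fun p : X × X × X =>
        densMeasure μ (fun z => h z ^ 2) (ball p.1 √t) := hVm.comp measurable_fst
    have h4 : MeasurableSet {p : X × X × X | dist p.2.1 p.2.2 ≤ √t} :=
      measurableSet_le (by fun_prop) measurable_const
    refine h4.imp (measurableSet_le ?_ ?_)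
    · refine Measurable.mul (Measurable.ennreal_ofReal ?_) h3
      exact ((h1.div (by fun_prop)).sub (h2.div (by fun_prop))).abs
    · fun_prop
  rw [Measure.ae_prod_iff_ae_ae hS]
  have Ht := H √t hR
  simp only [ae_densMeasure_sq hhmeas hhpos, Real.sq_sqrt ht.le] at Ht
  filter_upwards [Ht] with x hx
  refine (Measure.ae_prod_iff_ae_ae (measurable_prodMk_left (x := x) hS)).2 ?_
  filter_upwards [hx] with y hy
  filter_upwards [hy] with y' hy' hd
  have e : -dist x y ^ 2 / (4 * c₂ * t) = -((dist x y / √t) ^ 2 / (4 * c₂)) := by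
    rw [div_pow, Real.sq_sqrt ht.le, div_div, neg_div, mul_comm t]
  rw [← ENNReal.ofReal_toReal (hk.ball_ne_top x hR), ← ENNReal.ofReal_mul (abs_nonneg _), e]
  exact ENNReal.ofReal_le_ofReal (hy' hd)

end
end

section
/- Let (X,d,μ) be a metric measure space, let T be a heat-kernel family on (X,μ), and let h : X → (0,∞) be measurable such that the matched two-sided Gaussian estimate (ULG_h) holds and such that 0 < μ_{h²}(B) < ∞ for every ball B. Then the measure μ_{h²} is doubling: there exists a constant C' > 0 such that μ_{h²}(B(x,2r)) ≤ C' μ_{h²}(B(x,r)) for every x ∈ X and r > 0. -/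
open MeasureTheory Metric Filter Set
open scoped ENNReal NNReal

noncomputable section

variable {X : Type*} [MetricSpace X] [MeasurableSpace X] [BorelSpace X]

set_option linter.unusedSectionVars false

/-- If all balls have finite positive measure for the density `w`, then `μ` itself is s-finite. -/
lemma sFinite_of_ballsFinitePos {μ : Measure X} {w : X → ℝ} (hw : Measurable w)
    (hpos : ∀ x, 0 < w x) (hfin : BallsFinitePos (densMeasure μ w)) : SFinite μ := by
  rcases isEmpty_or_nonempty X with hX | ⟨⟨x₀⟩⟩
  · rw [Measure.eq_zero_of_isEmpty μ]
    infer_instance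
  have hσ : SigmaFinite (densMeasure μ w) :=
    ⟨⟨{ set := fun n => ball x₀ (n + 1)
        set_mem := fun _ => trivial
        finite := fun n => (hfin x₀ (n + 1) (by positivity)).2
        spanning := iUnion_ball_nat_succ x₀ }⟩⟩
  have hinv := withDensity_inv_same (μ := μ) (f := fun x => ENNReal.ofReal (w x))
    hw.ennreal_ofReal (ae_of_all _ fun x => by simpa using hpos x)
    (ae_of_all _ fun x => ENNReal.ofReal_ne_top)
  rw [← hinv]
  change SFinite ((densMeasure μ w).withDensity _)
  infer_instance

/-- A property holding almost everywhere holds at some point of every ball. -/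
lemma exists_mem_ball_of_ae {μ : Measure X} {w : X → ℝ}
    (hfin : BallsFinitePos (densMeasure μ w)) {p : X → Prop} (hp : ∀ᵐ x ∂μ, p x)
    (x : X) {r : ℝ} (hr : 0 < r) : ∃ y ∈ ball x r, p y := by
  refine Measure.exists_mem_of_measure_ne_zero_of_ae (μ := μ) (fun h0 => ?_) (ae_restrict_of_ae hp)
  exact (hfin x r hr).1.ne' (withDensity_absolutelyContinuous μ _ h0)

/-- Integrating the product of two Gaussian lower bounds over a ball through the semigroup
property. -/
lemma const_mul_densMeasure_le {μ : Measure X} {T : ℝ → X → X → ℝ} {h : X → ℝ}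
    (hT : IsHeatKernel μ T) (hhpos : ∀ x, 0 < h x)
    {t a : ℝ} (ha : 0 ≤ a) {x y : X} {B : Set X} (hB : MeasurableSet B) {U V : ℝ≥0∞}
    (hU : U ≠ ⊤) (hV : V ≠ ⊤)
    (hsemi : T (t + t) x y = ∫ z, T t x z * T t z y ∂μ) (hTpos : 0 < T (t + t) x y)
    (hx : ∀ᵐ z ∂μ, z ∈ B →
      ENNReal.ofReal (a * (h x * h z)) ≤ ENNReal.ofReal (T t x z) * U)
    (hy : ∀ᵐ z ∂μ, z ∈ B →
      ENNReal.ofReal (a * (h y * h z)) ≤ ENNReal.ofReal (T t y z) * V) :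
    ENNReal.ofReal (a ^ 2 * (h x * h y)) * densMeasure μ (fun z => h z ^ 2) B
      ≤ ENNReal.ofReal (T (t + t) x y) * (U * V) := by
  have hint : Integrable (fun z => T t x z * T t z y) μ := by
    by_contra hni
    rw [integral_undef hni] at hsemi
    exact hTpos.ne' hsemi
  rw [densMeasure, withDensity_apply _ hB, hsemi, ofReal_integral_eq_lintegral_ofReal hint
    (ae_of_all _ fun z => mul_nonneg (hT.nonneg _ _ _) (hT.nonneg _ _ _)),
    ← lintegral_const_mul' _ _ ENNReal.ofReal_ne_top,
    ← lintegral_mul_const' _ _ (ENNReal.mul_ne_top hU hV)]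
  refine (setLIntegral_mono_ae' hB ?_).trans (setLIntegral_le_lintegral B _)
  filter_upwards [hx, hy] with z hxz hyz hz
  have key := mul_le_mul' (hxz hz) (hyz hz)
  have h1 := (hhpos x).le
  have h2 := (hhpos y).le
  have h3 := (hhpos z).le
  rw [← ENNReal.ofReal_mul (by positivity)] at key ⊢
  rw [hT.symm t z y, ENNReal.ofReal_mul (hT.nonneg _ _ _)]
  calc _ = _ := by congr 1; ring
    _ ≤ _ := key
    _ = _ := by ring

/-- For a fixed radius, the matched Gaussian estimate yields volume comparison at almost every
centre. -/
lemma ae_densMeasure_ball_le {μ : Measure X} {T : ℝ → X → X → ℝ} {h : X → ℝ} {C c₁ c₂ : ℝ}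
    (hT : IsHeatKernel μ T) (hhmeas : Measurable h) (hhpos : ∀ x, 0 < h x)
    (hULG : ULG μ T h C c₁ c₂) (hfin : BallsFinitePos (densMeasure μ fun z => h z ^ 2))
    {r : ℝ} (hr : 0 < r) :
    ∀ᵐ x ∂μ, densMeasure μ (fun z => h z ^ 2) (ball x (3 * r))
      ≤ ENNReal.ofReal (C / (C⁻¹ * Real.exp (-16 / c₁)) ^ 2)
        * densMeasure μ (fun z => h z ^ 2) (ball x r) := by
  obtain ⟨hC, hc₁, hc₂, hG⟩ := hULG
  have : SFinite μ := sFinite_of_ballsFinitePos (hhmeas.pow_const 2)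
    (fun x => pow_pos (hhpos x) 2) hfin
  have ht : 0 < r ^ 2 := by positivity
  have hlow := Measure.ae_ae_of_ae_prod (hG (r ^ 2) ht)
  have hhigh := Measure.ae_ae_of_ae_prod (hG (r ^ 2 + r ^ 2) (by positivity))
  have hsemi := Measure.ae_ae_of_ae_prod (hT.semigroup (r ^ 2) (r ^ 2) ht ht)
  filter_upwards [hlow, hhigh, hsemi] with x hxlow hxhigh hxsemi
  obtain ⟨y, hyx, hylow, hyhigh, hysemi⟩ := exists_mem_ball_of_ae hfin
    (hlow.and (hxhigh.and hxsemi)) x (r := (2 / 5) * r) (by positivity)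
  rw [mem_ball] at hyx
  dsimp only at hxlow hylow hyhigh hysemi
  rw [Real.sqrt_sq hr.le] at hxlow hylow
  set ν := densMeasure μ fun z => h z ^ 2
  set s := Real.sqrt (r ^ 2 + r ^ 2)
  set a := C⁻¹ * Real.exp (-16 / c₁)
  have ha : 0 < a := by positivity
  have hxy : 0 < h x * h y := mul_pos (hhpos x) (hhpos y)
  have hlower : ∀ {u z : X}, dist u z ≤ 4 * r → ENNReal.ofReal (a * (h u * h z)) ≤
      ENNReal.ofReal (C⁻¹ * (h u * h z) * Real.exp (-(dist u z) ^ 2 / (c₁ * r ^ 2))) := by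
    intro u z hd
    have := hhpos u
    have := hhpos z
    apply ENNReal.ofReal_le_ofReal
    rw [show a * (h u * h z) = C⁻¹ * (h u * h z) * Real.exp (-16 / c₁) by simp only [a]; ring]
    have hexp : -16 / c₁ ≤ -(dist u z) ^ 2 / (c₁ * r ^ 2) := by
      rw [div_le_div_iff₀ hc₁ (by positivity)]
      have : dist u z ^ 2 ≤ (4 * r) ^ 2 := by gcongr
      nlinarith
    exact mul_le_mul_of_nonneg_left (Real.exp_le_exp.2 hexp) (by positivity)
  have hs : (7 / 5) * r ≤ s := Real.le_sqrt_of_sq_le (by nlinarith)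
  have hTpos : 0 < T (r ^ 2 + r ^ 2) x y := by
    by_contra hn
    have h1 := hyhigh.1
    rw [ENNReal.ofReal_of_nonpos (not_lt.1 hn), zero_mul, nonpos_iff_eq_zero,
      ENNReal.ofReal_eq_zero] at h1
    exact absurd h1 (not_le.2 (by positivity))
  have hupper : ENNReal.ofReal (T (r ^ 2 + r ^ 2) x y) * ν (ball x s)
      ≤ ENNReal.ofReal (C * (h x * h y)) := by
    refine hyhigh.2.trans (ENNReal.ofReal_le_ofReal ?_)
    refine mul_le_of_le_one_right (by positivity) (Real.exp_le_one_iff.2 ?_)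
    exact div_nonpos_of_nonpos_of_nonneg (by simp) (by positivity)
  have hmain := const_mul_densMeasure_le hT hhpos ha.le
    (measurableSet_ball (x := x) (ε := 3 * r))
    (hfin x r hr).2.ne (hfin y r hr).2.ne hysemi hTpos
    (hxlow.mono fun z hz hzB => (hlower (by
      rw [mem_ball, dist_comm] at hzB; linarith)).trans hz.1)
    (hylow.mono fun z hz hzB => (hlower (by
      rw [mem_ball, dist_comm] at hzB; linarith [dist_triangle y x z])).trans hz.1)
  have hyball : ν (ball y r) ≤ ν (ball x s) :=
    measure_mono (ball_subset_ball' (by linarith))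
  have hle : ENNReal.ofReal (a ^ 2 * (h x * h y)) * ν (ball x (3 * r))
      ≤ ENNReal.ofReal (C * (h x * h y)) * ν (ball x r) := by
    calc _ ≤ _ := hmain
      _ ≤ ENNReal.ofReal (T (r ^ 2 + r ^ 2) x y) * (ν (ball x r) * ν (ball x s)) := by gcongr
      _ = ENNReal.ofReal (T (r ^ 2 + r ^ 2) x y) * ν (ball x s) * ν (ball x r) := by ring
      _ ≤ _ := by gcongr
  have hpos : 0 < a ^ 2 * (h x * h y) := by positivity
  rw [← ENNReal.mul_le_mul_iff_right (ENNReal.ofReal_pos.2 hpos).ne' ENNReal.ofReal_ne_top,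
    ← mul_assoc (ENNReal.ofReal _), ← ENNReal.ofReal_mul hpos.le]
  convert hle using 3
  field_simp

/-- under (ULG_h), the measure `μ_{h²}` is doubling. -/
theorem stmt_6
    (μ : Measure X) (T : ℝ → X → X → ℝ) (hT : IsHeatKernel μ T)
    (h : X → ℝ) (hhmeas : Measurable h) (hhpos : ∀ x, 0 < h x)
    (CU c₁ c₂ : ℝ) (hULG : ULG μ T h CU c₁ c₂)
    (hfin : BallsFinitePos (densMeasure μ fun z => h z ^ 2)) :
    ∃ C' : ℝ, 0 < C' ∧ ∀ (x : X) (r : ℝ), 0 < r →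
      densMeasure μ (fun z => h z ^ 2) (ball x (2 * r))
        ≤ ENNReal.ofReal C' * densMeasure μ (fun z => h z ^ 2) (ball x r) := by
  obtain ⟨hC, -⟩ := id hULG
  refine ⟨CU / (CU⁻¹ * Real.exp (-16 / c₁)) ^ 2, by positivity, fun x r hr => ?_⟩
  obtain ⟨y, hyx, hy⟩ := exists_mem_ball_of_ae hfin
    (ae_densMeasure_ball_le hT hhmeas hhpos hULG hfin (r := (3 / 4) * r) (by positivity))
    x (r := (1 / 4) * r) (by positivity)
  rw [mem_ball] at hyx
  calc _ ≤ densMeasure μ (fun z => h z ^ 2) (ball y (3 * ((3 / 4) * r))) :=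
        measure_mono (ball_subset_ball' (by rw [dist_comm]; linarith))
    _ ≤ _ := hy
    _ ≤ _ := by
      gcongr
      exact ball_subset_ball' (by linarith)

end
end
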